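/- Let (V, R|V, 𝓖) be a dense CF-approximation subspace of a CF-approximation space (U, R, 𝓕). Then 𝔠(V, R|V, 𝓖) = {E ∩ V : E ∈ 𝔠(U, R, 𝓕)}, the map E ↦ E ∩ V is an order-isomorphism, and hence (𝔠(U, R, 𝓕), ⊆) is order-isomorphic to (𝔠(V, R|V, 𝓖), ⊆). -/

import Mathlib

open Set

/-- The upper approximation operator: `upp R A = {x | ∃ y ∈ A, x R y}`. -/
def upp {U : Type*} (R : U → U → Prop) (A : Set U) : Set U := {x | ∃ y ∈ A, R x y}

/-- `(U, R, 𝓕)` is a CF-approximation space. -/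
def IsCFApprox {U : Type*} (R : U → U → Prop) (𝓕 : Set (Set U)) : Prop :=
  Transitive R ∧ 𝓕.Nonempty ∧ (∀ F ∈ 𝓕, F.Finite) ∧
    ∀ F ∈ 𝓕, ∀ K : Set U, K.Finite → K ⊆ upp R F →
      ∃ G ∈ 𝓕, K ⊆ upp R G ∧ G ⊆ upp R F

/-- `E` is a CF-closed set of `(U, R, 𝓕)`. -/
def CFClosed {U : Type*} (R : U → U → Prop) (𝓕 : Set (Set U)) (E : Set U) : Prop :=
  ∀ K : Set U, K.Finite → K ⊆ E →
    ∃ F ∈ 𝓕, K ⊆ upp R F ∧ upp R F ⊆ E ∧ F ⊆ E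

/-- The join saturation `𝓕^♯`: all unions of nonempty finite subfamilies of `𝓕`. -/
def joinSat {U : Type*} (𝓕 : Set (Set U)) : Set (Set U) :=
  {A | ∃ 𝓐 : Set (Set U), 𝓐 ⊆ 𝓕 ∧ 𝓐.Finite ∧ 𝓐.Nonempty ∧ A = ⋃₀ 𝓐}

/-- `S(M, F)`: the set of `G ∈ 𝓕` satisfying (sL-1) and (sL-2). -/
def SFam {U : Type*} (R : U → U → Prop) (𝓕 : Set (Set U)) (M F : Set U) : Set (Set U) :=
  {G | G ∈ 𝓕 ∧ upp R M ⊆ upp R G ∧ upp R G ⊆ upp R F ∧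
    ∀ G' ∈ 𝓕, upp R M ⊆ upp R G' → upp R G' ⊆ upp R F → upp R G ⊆ upp R G'}

/-- `S*(M, F) = {G ∈ S(M, F) | G ⊆ upp R F}`. -/
def SStar {U : Type*} (R : U → U → Prop) (𝓕 : Set (Set U)) (M F : Set U) : Set (Set U) :=
  {G | G ∈ SFam R 𝓕 M F ∧ G ⊆ upp R F}

/-- sL-approximation space. -/
def IsSLApprox {U : Type*} (R : U → U → Prop) (𝓕 : Set (Set U)) : Prop :=
  IsCFApprox R 𝓕 ∧
    ∀ M ∈ joinSat 𝓕, ∀ F ∈ 𝓕, M ⊆ upp R F → (SFam R 𝓕 M F).Nonempty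

/-- L-approximation space. -/
def IsLApprox {U : Type*} (R : U → U → Prop) (𝓕 : Set (Set U)) : Prop :=
  IsCFApprox R 𝓕 ∧
    ∀ M ∈ joinSat 𝓕 ∪ {(∅ : Set U)}, ∀ F ∈ 𝓕, M ⊆ upp R F → (SFam R 𝓕 M F).Nonempty

/-- bc-approximation space. -/
def IsBCApprox {U : Type*} (R : U → U → Prop) (𝓕 : Set (Set U)) : Prop :=
  IsCFApprox R 𝓕 ∧
    ∀ M ∈ joinSat 𝓕 ∪ {(∅ : Set U)}, ∀ F ∈ 𝓕, M ⊆ upp R F →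
      ∃ G ∈ 𝓕, upp R M ⊆ upp R G ∧ upp R G ⊆ upp R F ∧
        ∀ G' ∈ 𝓕, upp R M ⊆ upp R G' → upp R G ⊆ upp R G'

/-- A dcpo: every (nonempty) directed subset has a supremum. -/
def IsDcpo (P : Type*) [PartialOrder P] : Prop :=
  ∀ D : Set P, D.Nonempty → DirectedOn (· ≤ ·) D → ∃ s, IsLUB D s

/-- The way-below relation `x ≪ y`. -/
def WayBelow {P : Type*} [PartialOrder P] (x y : P) : Prop :=
  ∀ D : Set P, D.Nonempty → DirectedOn (· ≤ ·) D →
    ∀ s, IsLUB D s → y ≤ s → ∃ d ∈ D, x ≤ d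

/-- Continuous domain: a dcpo in which for every `x` the set `{z | z ≪ x}` is
directed with supremum `x`. -/
def IsContinuousDomain (P : Type*) [PartialOrder P] : Prop :=
  IsDcpo P ∧ ∀ x : P, {z | WayBelow z x}.Nonempty ∧
    DirectedOn (· ≤ ·) {z | WayBelow z x} ∧ IsLUB {z | WayBelow z x} x

/-- Algebraic domain: a dcpo in which for every `x` the set `↓x ∩ K(P)` is
directed with supremum `x`. -/
def IsAlgebraicDomain (P : Type*) [PartialOrder P] : Prop :=
  IsDcpo P ∧ ∀ x : P, ({k | k ≤ x ∧ WayBelow k k}).Nonempty ∧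
    DirectedOn (· ≤ ·) {k | k ≤ x ∧ WayBelow k k} ∧
    IsLUB {k | k ≤ x ∧ WayBelow k k} x

/-- sL-domain: a continuous domain in which every principal ideal is a
sup-semilattice. -/
def IsSLDomain (P : Type*) [PartialOrder P] : Prop :=
  IsContinuousDomain P ∧ ∀ x a b : P, a ≤ x → b ≤ x →
    ∃ s, s ≤ x ∧ a ≤ s ∧ b ≤ s ∧ ∀ t, t ≤ x → a ≤ t → b ≤ t → s ≤ t

/-- L-domain: a continuous domain in which every principal ideal is a
complete lattice (every subset of `↓x` has a least upper bound in `↓x`). -/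
def IsLDomain (P : Type*) [PartialOrder P] : Prop :=
  IsContinuousDomain P ∧ ∀ (x : P) (A : Set P), (∀ a ∈ A, a ≤ x) →
    ∃ s, s ≤ x ∧ (∀ a ∈ A, a ≤ s) ∧ ∀ t, t ≤ x → (∀ a ∈ A, a ≤ t) → s ≤ t

/-- bc-domain: a continuous domain in which every up-bounded subset has a
supremum. -/
def IsBCDomain (P : Type*) [PartialOrder P] : Prop :=
  IsContinuousDomain P ∧ ∀ A : Set P, (∃ b, ∀ a ∈ A, a ≤ b) → ∃ s, IsLUB A s

lemma upp_mono {U : Type*} {R : U → U → Prop} {A B : Set U} (h : A ⊆ B) :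
    upp R A ⊆ upp R B :=
  fun _ ⟨y, hy, hxy⟩ => ⟨y, h hy, hxy⟩

lemma upp_upp_subset {U : Type*} {R : U → U → Prop}
    (hR : ∀ x y z, R x y → R y z → R x z) (A : Set U) : upp R (upp R A) ⊆ upp R A :=
  fun x ⟨y, ⟨z, hz, hyz⟩, hxy⟩ => ⟨z, hz, hR x y z hxy hyz⟩

lemma exists_finite_subset_upp {U : Type*} {R : U → U → Prop} {K A : Set U}
    (hK : K.Finite) (h : K ⊆ upp R A) : ∃ L ⊆ A, L.Finite ∧ K ⊆ upp R L := by
  have : Finite K := hK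
  have hex : ∀ x : K, ∃ y ∈ A, R x y := fun x => h x.2
  choose f hfA hfR using hex
  exact ⟨range f, range_subset_iff.2 hfA, finite_range f,
    fun x hx => ⟨f ⟨x, hx⟩, mem_range_self _, hfR ⟨x, hx⟩⟩⟩

lemma CFClosed.upp_subset {U : Type*} {R : U → U → Prop} {𝓕 : Set (Set U)} {E : Set U}
    (hR : ∀ x y z, R x y → R y z → R x z) (hE : CFClosed R 𝓕 E) : upp R E ⊆ E := by
  rintro x ⟨y, hy, hxy⟩
  obtain ⟨F, -, hyF, hFE, -⟩ := hE {y} (finite_singleton y) (singleton_subset_iff.2 hy)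
  exact hFE (upp_upp_subset hR F ⟨y, hyF rfl, hxy⟩)

lemma CFClosed.subset_upp {U : Type*} {R : U → U → Prop} {𝓕 : Set (Set U)} {E : Set U}
    (hE : CFClosed R 𝓕 E) : E ⊆ upp R E := by
  intro x hx
  obtain ⟨F, -, hxF, -, hFE⟩ := hE {x} (finite_singleton x) (singleton_subset_iff.2 hx)
  exact upp_mono hFE (hxF rfl)

lemma CFClosed.preimage_val {U : Type*} {R : U → U → Prop} {𝓕 𝓖 : Set (Set U)}
    {V E : Set U} (hR : ∀ x y z, R x y → R y z → R x z) (h𝓖V : ∀ G ∈ 𝓖, G ⊆ V)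
    (hdense : ∀ K : Set U, K.Finite → ∀ F ∈ 𝓕, K ⊆ upp R F →
      ∃ G ∈ 𝓖, K ⊆ upp R G ∧ G ⊆ upp R F)
    (hE : CFClosed R 𝓕 E) :
    CFClosed (fun a b : V => R a.1 b.1) {G' : Set V | Subtype.val '' G' ∈ 𝓖}
      (Subtype.val ⁻¹' E) := by
  intro K hK hKE
  obtain ⟨F, hF, hKF, hFE, -⟩ := hE (Subtype.val '' K) (hK.image _) (image_subset_iff.2 hKE)
  obtain ⟨G, hG, hKG, hGF⟩ := hdense _ (hK.image _) F hF hKF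
  have hGE : G ⊆ E := hGF.trans hFE
  refine ⟨Subtype.val ⁻¹' G, ?_, ?_, ?_, fun x hx => hGE hx⟩
  · rw [mem_ofPred_eq, Subtype.image_preimage_coe, inter_eq_right.2 (h𝓖V G hG)]
    exact hG
  · intro x hx
    obtain ⟨y, hy, hxy⟩ := hKG (mem_image_of_mem _ hx)
    exact ⟨⟨y, h𝓖V G hG hy⟩, hy, hxy⟩
  · rintro x ⟨y, hy, hxy⟩
    exact hE.upp_subset hR ⟨y, hGE hy, hxy⟩

lemma CFClosed.upp_image_val {U : Type*} {R : U → U → Prop} {𝓕 𝓖 : Set (Set U)}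
    {V : Set U} {E : Set V} (hR : ∀ x y z, R x y → R y z → R x z) (h𝓖𝓕 : 𝓖 ⊆ 𝓕)
    (hE : CFClosed (fun a b : V => R a.1 b.1) {G' : Set V | Subtype.val '' G' ∈ 𝓖} E) :
    CFClosed R 𝓕 (upp R (Subtype.val '' E)) := by
  intro K hK hKE
  obtain ⟨L, hLE, hL, hKL⟩ := exists_finite_subset_upp hK hKE
  obtain ⟨M, hME, rfl⟩ := subset_image_iff.1 hLE
  obtain ⟨G, hG, hMG, -, hGE⟩ := hE M (hL.of_finite_image Subtype.val_injective.injOn) hME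
  refine ⟨Subtype.val '' G, h𝓖𝓕 hG, ?_, upp_mono (image_mono hGE), ?_⟩
  · refine (hKL.trans (upp_mono ?_)).trans (upp_upp_subset hR _)
    rintro _ ⟨x, hx, rfl⟩
    obtain ⟨y, hy, hxy⟩ := hMG hx
    exact ⟨y, mem_image_of_mem _ hy, hxy⟩
  · rintro _ ⟨x, hx, rfl⟩
    obtain ⟨y, hy, hxy⟩ := hE.subset_upp (hGE hx)
    exact ⟨y, mem_image_of_mem _ hy, hxy⟩

lemma CFClosed.preimage_upp_image_val {U : Type*} {R : U → U → Prop} {V : Set U}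
    {𝓖 : Set (Set V)} {E : Set V} (hR : ∀ x y z, R x y → R y z → R x z)
    (hE : CFClosed (fun a b : V => R a.1 b.1) 𝓖 E) :
    Subtype.val ⁻¹' upp R (Subtype.val '' E) = E := by
  apply Subset.antisymm
  · rintro x ⟨_, ⟨y, hy, rfl⟩, hxy⟩
    exact CFClosed.upp_subset (R := fun a b : V => R a.1 b.1)
      (fun a b c => hR a b c) hE ⟨y, hy, hxy⟩
  · intro x hx
    obtain ⟨y, hy, hxy⟩ := hE.subset_upp hx
    exact ⟨y, mem_image_of_mem _ hy, hxy⟩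

lemma CFClosed.upp_image_preimage_val {U : Type*} {R : U → U → Prop} {𝓕 𝓖 : Set (Set U)}
    {V E : Set U} (hR : ∀ x y z, R x y → R y z → R x z) (h𝓖V : ∀ G ∈ 𝓖, G ⊆ V)
    (hdense : ∀ K : Set U, K.Finite → ∀ F ∈ 𝓕, K ⊆ upp R F →
      ∃ G ∈ 𝓖, K ⊆ upp R G ∧ G ⊆ upp R F)
    (hE : CFClosed R 𝓕 E) :
    upp R (Subtype.val '' (Subtype.val ⁻¹' E : Set V)) = E := by
  apply Subset.antisymm
  · exact (upp_mono (image_preimage_subset _ _)).trans (hE.upp_subset hR)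
  · intro x hx
    obtain ⟨F, hF, hxF, hFE, -⟩ := hE {x} (finite_singleton x) (singleton_subset_iff.2 hx)
    obtain ⟨G, hG, hxG, hGF⟩ := hdense _ (finite_singleton x) F hF hxF
    obtain ⟨y, hy, hxy⟩ := hxG rfl
    exact ⟨y, ⟨⟨y, h𝓖V G hG hy⟩, hFE (hGF hy), rfl⟩, hxy⟩

/-- for a dense CF-approximation subspace `(V, R|V, 𝓖)` of
`(U, R, 𝓕)`, the CF-closed sets of the subspace are exactly the sets `E ∩ V`
with `E` CF-closed in `(U, R, 𝓕)`, and `E ↦ E ∩ V` is an order isomorphism. -/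
theorem stmt1 {U : Type*} (R : U → U → Prop) (𝓕 : Set (Set U))
    (V : Set U) (𝓖 : Set (Set U))
    (hCF : IsCFApprox R 𝓕) (h𝓖𝓕 : 𝓖 ⊆ 𝓕) (h𝓖V : ∀ G ∈ 𝓖, G ⊆ V)
    (hdense : ∀ K : Set U, K.Finite → ∀ F ∈ 𝓕, K ⊆ upp R F →
      ∃ G ∈ 𝓖, K ⊆ upp R G ∧ G ⊆ upp R F) :
    {E' : Set V | CFClosed (fun a b : V => R a.1 b.1)
        {G' : Set V | Subtype.val '' G' ∈ 𝓖} E'}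
      = (fun E : Set U => (Subtype.val ⁻¹' E : Set V)) '' {E | CFClosed R 𝓕 E} ∧
    ∃ f : {E : Set U // CFClosed R 𝓕 E} ≃o
        {E' : Set V // CFClosed (fun a b : V => R a.1 b.1)
          {G' : Set V | Subtype.val '' G' ∈ 𝓖} E'},
      ∀ E : {E : Set U // CFClosed R 𝓕 E},
        (f E).1 = (Subtype.val ⁻¹' E.1 : Set V) := by
  have hR : ∀ x y z, R x y → R y z → R x z := fun _ _ _ hxy hyz => hCF.1 hxy hyz
  refine ⟨Subset.antisymm ?_ ?_, ?_⟩
  · exact fun E' hE' => ⟨_, hE'.upp_image_val hR h𝓖𝓕, hE'.preimage_upp_image_val hR⟩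
  · rintro _ ⟨E, hE, rfl⟩
    exact CFClosed.preimage_val hR h𝓖V hdense hE
  · refine ⟨{ toFun := fun E => ⟨_, E.2.preimage_val hR h𝓖V hdense⟩
              invFun := fun E' => ⟨_, E'.2.upp_image_val hR h𝓖𝓕⟩
              left_inv := fun E => Subtype.ext (E.2.upp_image_preimage_val hR h𝓖V hdense)
              right_inv := fun E' => Subtype.ext (E'.2.preimage_upp_image_val hR)
              map_rel_iff' := ?_ }, fun _ => rfl⟩
    intro E₁ E₂
    refine ⟨fun h => ?_, fun h => preimage_mono h⟩
    have h' : upp R (Subtype.val '' (Subtype.val ⁻¹' E₁.1 : Set V)) ⊆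
        upp R (Subtype.val '' (Subtype.val ⁻¹' E₂.1 : Set V)) := upp_mono (image_mono h)
    rwa [E₁.2.upp_image_preimage_val hR h𝓖V hdense,
      E₂.2.upp_image_preimage_val hR h𝓖V hdense] at h'
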